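/- Fix p ≥ 1, N ∈ ℕ with N ≥ 1, and L > 0, and let T : ℝ^N → ℝ be a (Borel measurable) function satisfying |T(ξ) − T(ξ')| ≤ (L/N)·∑_{k=1}^N c_p(ξ^k, ξ'^k)·|ξ^k − ξ'^k| for all ξ, ξ' ∈ ℝ^N. Then for all Borel probability measures P, Q on ℝ with ∫|t|^p dP < ∞ and ∫|t|^p dQ < ∞, d_K(P^{⊗N} ∘ T⁻¹, Q^{⊗N} ∘ T⁻¹) ≤ L·d_{FM,p}(P,Q) < ∞, where P^{⊗N} ∘ T⁻¹ denotes the pushforward of the product measure P^{⊗N} under T. -/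

import Mathlib

open MeasureTheory
open scoped ENNReal

/-- The local Lipschitz growth constant `c_p(x,y) = max{1,|x|,|y|}^(p−1)`. -/
noncomputable def cp (p x y : ℝ) : ℝ := max 1 (max |x| |y|) ^ (p - 1)

/-- The `p`-th order Fortet–Mourier distance between Borel probability measures on `ℝ`;
`dFM 1` is the Kantorovich distance. -/
noncomputable def dFM (p : ℝ) (P Q : Measure ℝ) : ℝ≥0∞ :=
  ⨆ ψ ∈ {ψ : ℝ → ℝ | ∀ x y : ℝ, |ψ x - ψ y| ≤ cp p x y * |x - y|},
    ENNReal.ofReal |∫ x, ψ x ∂P - ∫ x, ψ x ∂Q|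

theorem cp_zero_mul_abs_le (p x : ℝ) : cp p x 0 * |x| ≤ 1 + |x| ^ p := by
  have hx := abs_nonneg x
  have hcp : cp p x 0 = max 1 |x| ^ (p - 1) := by simp [cp]
  rw [hcp]
  rcases le_total |x| 1 with h | h
  · rw [max_eq_left h, Real.one_rpow]
    linarith [Real.rpow_nonneg hx p]
  · rw [max_eq_right h]
    have h0 : 0 < |x| := by linarith
    rw [Real.rpow_sub_one h0.ne', div_mul_cancel₀ _ h0.ne']
    linarith

theorem continuous_of_abs_sub_le_cp {p : ℝ} {ψ : ℝ → ℝ}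
    (hψ : ∀ x y : ℝ, |ψ x - ψ y| ≤ cp p x y * |x - y|) : Continuous ψ := by
  rw [continuous_iff_continuousAt]
  intro x
  have hc : Continuous fun y => cp p y x * |y - x| := by
    unfold cp
    refine Continuous.mul (Continuous.rpow_const (by fun_prop) fun y => Or.inl ?_) (by fun_prop)
    exact (lt_of_lt_of_le one_pos (le_max_left _ _)).ne'
  have ht := hc.tendsto x
  simp only [sub_self, abs_zero, mul_zero] at ht
  rw [ContinuousAt, tendsto_iff_dist_tendsto_zero]
  exact squeeze_zero (fun _ => dist_nonneg) (fun y => by rw [Real.dist_eq]; exact hψ y x) ht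

/-- A function with the `c_p` growth condition is integrable along coordinates with finite
`p`-th absolute moments. -/
theorem integrable_comp_of_abs_sub_le_sum_cp {p : ℝ} {n : ℕ} {a : ℝ} (ha : 0 ≤ a)
    {f : (Fin n → ℝ) → ℝ} (hfm : Measurable f)
    (hf : ∀ ξ ξ' : Fin n → ℝ, |f ξ - f ξ'| ≤ a * ∑ k, cp p (ξ k) (ξ' k) * |ξ k - ξ' k|)
    {Ω : Type*} [MeasurableSpace Ω] {ρ : Measure Ω} [IsFiniteMeasure ρ] {X : Ω → Fin n → ℝ}
    (hX : Measurable X) (hint : ∀ k, Integrable (fun ω => |X ω k| ^ p) ρ) :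
    Integrable (fun ω => f (X ω)) ρ := by
  have hdom : Integrable (fun ω => |f 0| + a * ∑ k, (1 + |X ω k| ^ p)) ρ :=
    (integrable_const _).add
      ((integrable_finsetSum _ fun k _ => (integrable_const _).add (hint k)).const_mul a)
  refine hdom.mono' (hfm.comp hX).aestronglyMeasurable (.of_forall fun ω => ?_)
  have h1 := hf (X ω) 0
  have h2 : ∑ k, cp p (X ω k) ((0 : Fin n → ℝ) k) * |X ω k - (0 : Fin n → ℝ) k|
      ≤ ∑ k, (1 + |X ω k| ^ p) :=
    Finset.sum_le_sum fun k _ => by simpa using cp_zero_mul_abs_le p (X ω k)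
  have h3 := mul_le_mul_of_nonneg_left h2 ha
  rw [Real.norm_eq_abs]
  have h4 := abs_sub_abs_le_abs_sub (f (X ω)) (f 0)
  linarith

theorem integral_pi_succ (n : ℕ) (P : Measure ℝ) [IsProbabilityMeasure P]
    (f : (Fin (n + 1) → ℝ) → ℝ) :
    ∫ ξ, f ξ ∂(Measure.pi fun _ : Fin (n + 1) => P)
      = ∫ z : ℝ × (Fin n → ℝ), f (Fin.cons z.1 z.2) ∂(P.prod (Measure.pi fun _ : Fin n => P)) := by
  have h := (measurePreserving_piFinSuccAbove (fun _ : Fin (n + 1) => P) 0).symm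
  rw [← h.integral_comp']
  simp [MeasurableEquiv.piFinSuccAbove, Fin.insertNthEquiv]

theorem measurable_cons (n : ℕ) :
    Measurable fun z : ℝ × (Fin n → ℝ) => (Fin.cons z.1 z.2 : Fin (n + 1) → ℝ) := by
  refine measurable_pi_lambda _ fun k => ?_
  refine Fin.cases ?_ (fun i => ?_) k
  · simpa using measurable_fst
  · simpa [Function.comp_def] using (measurable_pi_apply i).comp measurable_snd

theorem integrable_eval_pi {p : ℝ} {n : ℕ} {P : Measure ℝ} [IsProbabilityMeasure P]
    (hP : Integrable (fun t : ℝ => |t| ^ p) P) (k : Fin n) :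
    Integrable (fun ξ : Fin n → ℝ => |ξ k| ^ p) (Measure.pi fun _ : Fin n => P) :=
  (measurePreserving_eval (fun _ : Fin n => P) k).integrable_comp_of_integrable hP

/-- Replacing the coordinates of a product measure one at a time. -/
theorem abs_integral_pi_sub_integral_pi_le {p : ℝ} {a D : ℝ} (ha : 0 < a)
    {P Q : Measure ℝ} [IsProbabilityMeasure P] [IsProbabilityMeasure Q]
    (hP : Integrable (fun t : ℝ => |t| ^ p) P) (hQ : Integrable (fun t : ℝ => |t| ^ p) Q)
    (hD : ∀ ψ : ℝ → ℝ, (∀ x y : ℝ, |ψ x - ψ y| ≤ cp p x y * |x - y|) →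
      |∫ x, ψ x ∂P - ∫ x, ψ x ∂Q| ≤ D) (n : ℕ) (f : (Fin n → ℝ) → ℝ) (hfm : Measurable f)
    (hf : ∀ ξ ξ' : Fin n → ℝ, |f ξ - f ξ'| ≤ a * ∑ k, cp p (ξ k) (ξ' k) * |ξ k - ξ' k|) :
    |∫ ξ, f ξ ∂(Measure.pi fun _ : Fin n => P) - ∫ ξ, f ξ ∂(Measure.pi fun _ : Fin n => Q)|
      ≤ n * (a * D) := by
  induction n with
  | zero =>
    have hc : ∀ ξ, f ξ = f 0 := fun ξ => congrArg f (Subsingleton.elim _ _)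
    simp [hc]
  | succ n ih =>
    have hsec : ∀ (R : Measure ℝ) [IsProbabilityMeasure R], Integrable (fun t : ℝ => |t| ^ p) R →
        ∀ x : ℝ, Integrable (fun η : Fin n → ℝ => f (Fin.cons x η))
          (Measure.pi fun _ : Fin n => R) := by
      intro R _ hR x
      refine integrable_comp_of_abs_sub_le_sum_cp ha.le hfm hf
        ((measurable_cons n).comp measurable_prodMk_left) fun k => ?_
      refine Fin.cases ?_ (fun i => ?_) k
      · simp
      · simpa using integrable_eval_pi hR i
    have hprod : ∀ (R S : Measure ℝ) [IsProbabilityMeasure R] [IsProbabilityMeasure S],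
        Integrable (fun t : ℝ => |t| ^ p) R → Integrable (fun t : ℝ => |t| ^ p) S →
        Integrable (fun z : ℝ × (Fin n → ℝ) => f (Fin.cons z.1 z.2))
          (R.prod (Measure.pi fun _ : Fin n => S)) := by
      intro R S _ _ hR hS
      refine integrable_comp_of_abs_sub_le_sum_cp ha.le hfm hf (measurable_cons n) fun k => ?_
      refine Fin.cases ?_ (fun i => ?_) k
      · simpa using hR.comp_fst (Measure.pi fun _ : Fin n => S)
      · simpa using (integrable_eval_pi hS i).comp_snd R
    rw [integral_pi_succ, integral_pi_succ, integral_prod _ (hprod P P hP hP),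
      integral_prod _ (hprod Q Q hQ hQ)]
    set g : ℝ → ℝ := fun x => ∫ η, f (Fin.cons x η) ∂(Measure.pi fun _ : Fin n => P) with hg
    set h : ℝ → ℝ := fun x => ∫ η, f (Fin.cons x η) ∂(Measure.pi fun _ : Fin n => Q)
    have hgQ : Integrable g Q := (hprod Q P hQ hP).integral_prod_left
    have hhQ : Integrable h Q := (hprod Q Q hQ hQ).integral_prod_left
    have hglip : ∀ x y, |g x - g y| ≤ a * (cp p x y * |x - y|) := by
      intro x y
      rw [hg, ← integral_sub (hsec P hP x) (hsec P hP y), ← Real.norm_eq_abs]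
      refine (norm_integral_le_of_norm_le_const (C := a * (cp p x y * |x - y|))
        (.of_forall fun η => ?_)).trans_eq ?_
      · simpa [Fin.sum_univ_succ] using hf (Fin.cons x η) (Fin.cons y η)
      · simp
    have h1 : |∫ x, g x ∂P - ∫ x, g x ∂Q| ≤ a * D := by
      have := hD (fun x => a⁻¹ * g x) fun x y => by
        rw [← mul_sub, abs_mul, abs_of_pos (inv_pos.2 ha), inv_mul_le_iff₀ ha]
        exact hglip x y
      rwa [integral_const_mul, integral_const_mul, ← mul_sub, abs_mul, abs_of_pos (inv_pos.2 ha),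
        inv_mul_le_iff₀ ha] at this
    have h2 : |∫ x, g x ∂Q - ∫ x, h x ∂Q| ≤ n * (a * D) := by
      rw [← integral_sub hgQ hhQ, ← Real.norm_eq_abs]
      refine (norm_integral_le_of_norm_le_const (C := n * (a * D))
        (.of_forall fun x => ?_)).trans_eq ?_
      · refine ih (fun η => f (Fin.cons x η))
          (hfm.comp ((measurable_cons n).comp measurable_prodMk_left)) fun ξ ξ' => ?_
        simpa [Fin.sum_univ_succ] using hf (Fin.cons x ξ) (Fin.cons x ξ')
      · simp
    have h3 := abs_sub_le (∫ x, g x ∂P) (∫ x, g x ∂Q) (∫ x, h x ∂Q)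
    push_cast
    linarith

theorem dFM_lt_top {p : ℝ} {P Q : Measure ℝ} [IsProbabilityMeasure P]
    [IsProbabilityMeasure Q] (hP : Integrable (fun t : ℝ => |t| ^ p) P)
    (hQ : Integrable (fun t : ℝ => |t| ^ p) Q) : dFM p P Q < ⊤ := by
  refine lt_of_le_of_lt (b := ENNReal.ofReal
    ((∫ x, (1 + |x| ^ p) ∂P) + ∫ x, (1 + |x| ^ p) ∂Q)) ?_ ENNReal.ofReal_lt_top
  refine iSup₂_le fun ψ hψ => ENNReal.ofReal_le_ofReal ?_
  have hbound : ∀ (ν : Measure ℝ) [IsProbabilityMeasure ν], Integrable (fun t : ℝ => |t| ^ p) ν →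
      |∫ x, ψ x ∂ν - ψ 0| ≤ ∫ x, (1 + |x| ^ p) ∂ν := by
    intro ν _ hν
    have hdom : Integrable (fun x : ℝ => 1 + |x| ^ p) ν := (integrable_const _).add hν
    have hle : ∀ x, ‖ψ x - ψ 0‖ ≤ 1 + |x| ^ p := fun x => by
      have := hψ x 0
      rw [sub_zero] at this
      exact this.trans (cp_zero_mul_abs_le p x)
    have hi : Integrable (fun x => ψ x - ψ 0) ν :=
      hdom.mono' ((continuous_of_abs_sub_le_cp hψ).sub continuous_const).aestronglyMeasurable
        (.of_forall hle)
    have hψi : Integrable ψ ν :=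
      (hi.add (integrable_const (ψ 0))).congr (.of_forall fun x => sub_add_cancel _ _)
    have he : ∫ x, ψ x ∂ν - ψ 0 = ∫ x, (ψ x - ψ 0) ∂ν := by
      rw [integral_sub hψi (integrable_const _)]
      simp
    rw [he]
    exact norm_integral_le_of_norm_le hdom (.of_forall hle)
  have h1 := hbound P hP
  have h2 := hbound Q hQ
  have h3 := abs_sub_le (∫ x, ψ x ∂P) (ψ 0) (∫ x, ψ x ∂Q)
  rw [abs_sub_comm (ψ 0)] at h3
  linarith


/-- Let `p ≥ 1`, `N ≥ 1`, `L > 0`, and `T : ℝ^N → ℝ` be Borel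
measurable with `|T(ξ) − T(ξ')| ≤ (L/N)·∑ c_p(ξ^k, ξ'^k)·|ξ^k − ξ'^k|`. Then for all
probability measures `P, Q` on `ℝ` with finite `p`-th absolute moments,
`d_K(P^{⊗N} ∘ T⁻¹, Q^{⊗N} ∘ T⁻¹) ≤ L · d_{FM,p}(P,Q) < ∞`. -/
theorem quantitative_statistical_robustness (p : ℝ) (hp : 1 ≤ p) (N : ℕ) (hN : 1 ≤ N)
    (L : ℝ) (hL : 0 < L) (T : (Fin N → ℝ) → ℝ) (hTm : Measurable T)
    (hT : ∀ ξ ξ' : Fin N → ℝ,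
      |T ξ - T ξ'| ≤ (L / (N : ℝ)) * ∑ k, cp p (ξ k) (ξ' k) * |ξ k - ξ' k|)
    (P Q : Measure ℝ) [IsProbabilityMeasure P] [IsProbabilityMeasure Q]
    (hP : Integrable (fun t : ℝ => |t| ^ p) P) (hQ : Integrable (fun t : ℝ => |t| ^ p) Q) :
    dFM 1 ((Measure.pi fun _ : Fin N => P).map T) ((Measure.pi fun _ : Fin N => Q).map T)
      ≤ ENNReal.ofReal L * dFM p P Q ∧ ENNReal.ofReal L * dFM p P Q < ⊤ := by
  have hfin := dFM_lt_top hP hQ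
  refine ⟨?_, ENNReal.mul_lt_top ENNReal.ofReal_lt_top hfin⟩
  have hD : ∀ ψ : ℝ → ℝ, (∀ x y : ℝ, |ψ x - ψ y| ≤ cp p x y * |x - y|) →
      |∫ x, ψ x ∂P - ∫ x, ψ x ∂Q| ≤ (dFM p P Q).toReal := fun ψ hψ =>
    (ENNReal.ofReal_le_iff_le_toReal hfin.ne).1 (le_iSup₂_of_le ψ hψ le_rfl)
  have hN0 : (0 : ℝ) < N := by exact_mod_cast hN
  refine iSup₂_le fun ψ hψ => ?_
  have hψm : Measurable ψ := (continuous_of_abs_sub_le_cp hψ).measurable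
  rw [integral_map hTm.aemeasurable hψm.aestronglyMeasurable,
    integral_map hTm.aemeasurable hψm.aestronglyMeasurable]
  have hmain := abs_integral_pi_sub_integral_pi_le (div_pos hL hN0) hP hQ hD N
    (fun ξ => ψ (T ξ)) (hψm.comp hTm) fun ξ ξ' => by
      have h := hψ (T ξ) (T ξ')
      simp only [cp, sub_self, Real.rpow_zero, one_mul] at h
      exact h.trans (hT ξ ξ')
  rw [← mul_assoc, mul_div_cancel₀ _ hN0.ne'] at hmain
  calc _ ≤ ENNReal.ofReal (L * (dFM p P Q).toReal) := ENNReal.ofReal_le_ofReal hmain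
    _ = _ := by rw [ENNReal.ofReal_mul hL.le, ENNReal.ofReal_toReal hfin.ne]
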